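/- arXiv:2312.14989 — 4 statements merged into one kernel-verified Lean document; each statement's English description precedes it below -/
import Mathlib

section
/- (Single-ray explicit formula.) Let c ∈ ℂ with c ≠ 0 and c ≠ 1, β ∈ ℂ, and n ∈ ℕ. Then for every s ∈ ℂ, ((Ψ^{β+1} ∘ Ψ^{β+2} ∘ ⋯ ∘ Ψ^{β+n})(1))(s) = (c/(c−1))^n · Σ_{k=0}^{n} C(n,k) · c^{−k} · (−s)_k · (s+β)_{n−k}. -/
/-- The raising operator `(Ψ^β f)(s) = (c/(c−1))·((s+β−1)·f(s) − (s/c)·f(s−1))`. -/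
noncomputable def raisingOp (c β : ℂ) (f : ℂ → ℂ) : ℂ → ℂ :=
  fun s => (c / (c - 1)) * ((s + β - 1) * f s - (s / c) * f (s - 1))

/-- `R^β_k = Ψ^{β+1} ∘ Ψ^{β+2} ∘ ⋯ ∘ Ψ^{β+k}` (with `R^β_0` the identity). -/
noncomputable def iterRaising (c : ℂ) : ℂ → ℕ → (ℂ → ℂ) → (ℂ → ℂ)
  | _, 0, f => f
  | β, k + 1, f => raisingOp c (β + 1) (iterRaising c (β + 1) k f)

/-- The left recursion `(x)_{k+1} = x (x+1)_k` of the Pochhammer symbol. -/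
theorem ascPochhammer_eval_succ_left {R : Type*} [CommSemiring R] (k : ℕ) (x : R) :
    (ascPochhammer R (k + 1)).eval x = x * (ascPochhammer R k).eval (x + 1) := by
  simp [ascPochhammer_succ_left]

/-- Single-ray explicit formula:
`(Ψ^{β+1}∘⋯∘Ψ^{β+n})(1)(s) = (c/(c−1))^n · Σ_{k=0}^n C(n,k)·c^{−k}·(−s)_k·(s+β)_{n−k}`. -/
theorem meixner_single_ray_explicit (c β : ℂ) (hc0 : c ≠ 0) (hc1 : c ≠ 1)
    (n : ℕ) (s : ℂ) :
    iterRaising c β n (fun _ => 1) s =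
      (c / (c - 1)) ^ n *
        ∑ k ∈ Finset.range (n + 1),
          ((n.choose k : ℂ) / c ^ k) * (ascPochhammer ℂ k).eval (-s) *
            (ascPochhammer ℂ (n - k)).eval (s + β) := by
  induction n generalizing β s with
  | zero => simp [iterRaising]
  | succ n ih =>
    have pascal := Finset.sum_choose_succ_mul (R := ℂ)
      (fun k j => (ascPochhammer ℂ k).eval (-s) / c ^ k * (ascPochhammer ℂ j).eval (s + β)) n
    have hsum : ∑ k ∈ Finset.range (n + 1 + 1),
          (((n + 1).choose k : ℂ) / c ^ k) * (ascPochhammer ℂ k).eval (-s) *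
            (ascPochhammer ℂ (n + 1 - k)).eval (s + β) =
        (s + β) * ∑ k ∈ Finset.range (n + 1),
          ((n.choose k : ℂ) / c ^ k) * (ascPochhammer ℂ k).eval (-s) *
            (ascPochhammer ℂ (n - k)).eval (s + (β + 1)) -
        s / c * ∑ k ∈ Finset.range (n + 1),
          ((n.choose k : ℂ) / c ^ k) * (ascPochhammer ℂ k).eval (-(s - 1)) *
            (ascPochhammer ℂ (n - k)).eval (s - 1 + (β + 1)) := by
      rw [Finset.mul_sum, Finset.mul_sum, sub_eq_add_neg, ← Finset.sum_neg_distrib]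
      refine Eq.trans (Finset.sum_congr rfl fun k _ => by ring) (pascal.trans ?_)
      congr 1 <;> refine Finset.sum_congr rfl fun k hk => ?_
      · have hk' : n + 1 - k = n - k + 1 := by grind
        rw [hk', ascPochhammer_eval_succ_left, add_assoc s β 1]
        ring
      · rw [ascPochhammer_eval_succ_left, show -s + 1 = -(s - 1) by ring,
          show s - 1 + (β + 1) = s + β by ring]
        field_simp
        ring
    rw [hsum, iterRaising, raisingOp, ih, ih]
    ring
end

section
/- (Two-ray explicit formula.) Let c ∈ ℂ with c ≠ 0 and c ≠ 1, β, β' ∈ ℂ, and n, m ∈ ℕ. Then for every s ∈ ℂ, ((Ψ^{β+1} ∘ ⋯ ∘ Ψ^{β+n}) ∘ (Ψ^{β'+1} ∘ ⋯ ∘ Ψ^{β'+m})(1))(s) = (c/(c−1))^{n+m} · Σ_{k=0}^{n} Σ_{k'=0}^{m} C(n,k)·C(m,k') · c^{−k−k'} · (−s)_{k+k'} · (s+β)_{n−k} · (s+β'−k)_{m−k'}. -/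
/-- Splitting `(x)_{m+n} = (x)_m (x+m)_n`. -/
theorem ascPochhammer_eval_add {R : Type*} [CommRing R] (x : R) (m n : ℕ) :
    (ascPochhammer R (m + n)).eval x =
      (ascPochhammer R m).eval x * (ascPochhammer R n).eval (x + m) := by
  rw [← ascPochhammer_mul]
  simp

theorem ascPochhammer_succ_eval_left {R : Type*} [CommRing R] (x : R) (n : ℕ) :
    (ascPochhammer R (n + 1)).eval x = x * (ascPochhammer R n).eval (x + 1) := by
  simp [ascPochhammer_succ_left]

/-- Expansion of the iterated raising operator in shifts of its argument. -/
theorem iterRaising_apply (c β : ℂ) (n : ℕ) (f : ℂ → ℂ) (s : ℂ) :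
    iterRaising c β n f s =
      (c / (c - 1)) ^ n * ∑ k ∈ Finset.range (n + 1), (n.choose k : ℂ) *
        ((c ^ k)⁻¹ * (ascPochhammer ℂ k).eval (-s) *
          (ascPochhammer ℂ (n - k)).eval (s + β) * f (s - k)) := by
  induction n generalizing β s with
  | zero => simp [iterRaising]
  | succ n ih =>
    rw [Finset.sum_choose_succ_mul (fun k j => (c ^ k)⁻¹ * (ascPochhammer ℂ k).eval (-s) *
      (ascPochhammer ℂ j).eval (s + β) * f (s - k))]
    have h_left : ∑ k ∈ Finset.range (n + 1), (n.choose k : ℂ) *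
        ((c ^ k)⁻¹ * (ascPochhammer ℂ k).eval (-s) *
          (ascPochhammer ℂ (n + 1 - k)).eval (s + β) * f (s - k)) =
        (s + β) * ∑ k ∈ Finset.range (n + 1), (n.choose k : ℂ) *
          ((c ^ k)⁻¹ * (ascPochhammer ℂ k).eval (-s) *
            (ascPochhammer ℂ (n - k)).eval (s + (β + 1)) * f (s - k)) := by
      rw [Finset.mul_sum]
      refine Finset.sum_congr rfl fun k hk => ?_
      rw [Nat.succ_sub (Finset.mem_range_succ_iff.mp hk), ascPochhammer_succ_eval_left, add_assoc s]
      ring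
    have h_right : ∑ k ∈ Finset.range (n + 1), (n.choose k : ℂ) *
        ((c ^ (k + 1))⁻¹ * (ascPochhammer ℂ (k + 1)).eval (-s) *
          (ascPochhammer ℂ (n - k)).eval (s + β) * f (s - (k + 1 : ℕ))) =
        -(s / c) * ∑ k ∈ Finset.range (n + 1), (n.choose k : ℂ) *
          ((c ^ k)⁻¹ * (ascPochhammer ℂ k).eval (-(s - 1)) *
            (ascPochhammer ℂ (n - k)).eval (s - 1 + (β + 1)) * f (s - 1 - k)) := by
      rw [Finset.mul_sum]
      refine Finset.sum_congr rfl fun k _ => ?_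
      rw [ascPochhammer_succ_eval_left, show -(s - 1) = -s + 1 by ring,
        show s - 1 + (β + 1) = s + β by ring,
        show s - ((k + 1 : ℕ) : ℂ) = s - 1 - k by push_cast; ring, pow_succ, mul_inv]
      ring
    rw [h_left, h_right, iterRaising, raisingOp, ih, ih]
    ring

/-- Two-ray explicit formula:
`(Ψ^{β+1}∘⋯∘Ψ^{β+n})∘(Ψ^{β'+1}∘⋯∘Ψ^{β'+m})(1)(s) = (c/(c−1))^{n+m} ·
 Σ_{k=0}^n Σ_{k'=0}^m C(n,k)C(m,k')·c^{−k−k'}·(−s)_{k+k'}·(s+β)_{n−k}·(s+β'−k)_{m−k'}`. -/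
theorem meixner_two_ray_explicit (c β β' : ℂ) (hc0 : c ≠ 0) (hc1 : c ≠ 1)
    (n m : ℕ) (s : ℂ) :
    iterRaising c β n (iterRaising c β' m (fun _ => 1)) s =
      (c / (c - 1)) ^ (n + m) *
        ∑ k ∈ Finset.range (n + 1), ∑ k' ∈ Finset.range (m + 1),
          ((n.choose k : ℂ) * (m.choose k' : ℂ) / c ^ (k + k')) *
            (ascPochhammer ℂ (k + k')).eval (-s) *
            (ascPochhammer ℂ (n - k)).eval (s + β) *
            (ascPochhammer ℂ (m - k')).eval (s + β' - (k : ℂ)) := by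
  simp only [iterRaising_apply, Finset.mul_sum]
  refine Finset.sum_congr rfl fun k _ => Finset.sum_congr rfl fun k' _ => ?_
  rw [ascPochhammer_eval_add, show -(s - k) = -s + (k : ℂ) by ring,
    show s - k + β' = s + β' - (k : ℂ) by ring, pow_add c, div_eq_mul_inv _ (c ^ k * c ^ k'),
    mul_inv]
  ring
end

section
/- Let c ∈ ℂ with c ≠ 0 and c ≠ 1, β ∈ ℂ, and let n ≥ 1 be an integer. Let s ∈ ℂ satisfy s − i ≠ 0 and s + β + n − i ≠ 1 for all integers 0 ≤ i ≤ n−1. Then (∇^{n−1} ρ^{β+n})(s) = (c/(c−1)) · (∇^{n} ρ^{β+n})(s) − ((β+n−1)/(c−1)) · (∇^{n−1} ρ^{β+n−1})(s). -/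
/-- The Meixner weight `ρ^β(s) = c^s · Γ(s+β) / Γ(s+1)` (principal branch of `c^s`). -/
noncomputable def meixnerWeight (c β s : ℂ) : ℂ :=
  c ^ s * Complex.Gamma (s + β) / Complex.Gamma (s + 1)

/-- The backward difference operator `(∇f)(s) = f(s) − f(s−1)`. -/
def nablaOp (f : ℂ → ℂ) : ℂ → ℂ := fun s => f s - f (s - 1)

theorem nablaOp_iterate_eq_of_eq_lincomb {f g h : ℂ → ℂ} (a b : ℂ) (k : ℕ) (s : ℂ)
    (hfgh : ∀ i : ℕ, i ≤ k → f (s - i) = a * g (s - i) - b * h (s - i)) :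
    (nablaOp^[k] f) s = a * (nablaOp^[k] g) s - b * (nablaOp^[k] h) s := by
  induction k generalizing s with
  | zero => simpa using hfgh 0 le_rfl
  | succ k ih =>
    have hs := ih s fun i hi => hfgh i (by lia)
    have hs' := ih (s - 1) fun i hi => by
      have hi' := hfgh (i + 1) (by lia)
      rwa [show s - ((i + 1 : ℕ) : ℂ) = s - 1 - i by push_cast; ring] at hi'
    simp only [Function.iterate_succ_apply', nablaOp, hs, hs']
    ring

theorem meixnerWeight_add_one (c γ t : ℂ) (h : t + γ ≠ 0) :
    meixnerWeight c (γ + 1) t = (t + γ) * meixnerWeight c γ t := by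
  simp only [meixnerWeight, ← add_assoc, Complex.Gamma_add_one _ h]
  ring

theorem meixnerWeight_add_one_sub_one {c : ℂ} (γ t : ℂ) (hc : c ≠ 0) (ht : t ≠ 0) :
    c * meixnerWeight c (γ + 1) (t - 1) = t * meixnerWeight c γ t := by
  have hΓ : t - 1 + (γ + 1) = t + γ := by ring
  simp only [meixnerWeight, hΓ, sub_add_cancel, Complex.Gamma_add_one _ ht,
    Complex.cpow_sub _ _ hc, Complex.cpow_one]
  field_simp

theorem meixnerWeight_add_one_eq_nablaOp {c : ℂ} (γ t : ℂ) (hc0 : c ≠ 0) (hc1 : c ≠ 1)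
    (ht : t ≠ 0) (h : t + γ ≠ 0) :
    meixnerWeight c (γ + 1) t =
      c / (c - 1) * nablaOp (meixnerWeight c (γ + 1)) t -
        γ / (c - 1) * meixnerWeight c γ t := by
  have hc : c - 1 ≠ 0 := sub_ne_zero.mpr hc1
  have hadd := meixnerWeight_add_one c γ t h
  have hsub := meixnerWeight_add_one_sub_one γ t hc0 ht
  rw [nablaOp]
  field_simp
  linear_combination -hadd + hsub

/-- `(∇^{n−1} ρ^{β+n})(s) = (c/(c−1))·(∇^n ρ^{β+n})(s) − ((β+n−1)/(c−1))·(∇^{n−1} ρ^{β+n−1})(s)`. -/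
theorem nabla_pow_meixnerWeight_rec (c β : ℂ) (hc0 : c ≠ 0) (hc1 : c ≠ 1)
    (n : ℕ) (hn : 1 ≤ n) (s : ℂ)
    (h1 : ∀ i : ℕ, i ≤ n - 1 → s - (i : ℂ) ≠ 0)
    (h2 : ∀ i : ℕ, i ≤ n - 1 → s + β + (n : ℂ) - (i : ℂ) ≠ 1) :
    (nablaOp^[n - 1] (meixnerWeight c (β + (n : ℂ)))) s =
      (c / (c - 1)) * (nablaOp^[n] (meixnerWeight c (β + (n : ℂ)))) s -
        ((β + (n : ℂ) - 1) / (c - 1)) *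
          (nablaOp^[n - 1] (meixnerWeight c (β + (n : ℂ) - 1))) s := by
  obtain ⟨k, rfl⟩ : ∃ k, n = k + 1 := ⟨n - 1, by lia⟩
  simp only [Nat.add_sub_cancel] at h1 h2 ⊢
  rw [Function.iterate_succ_apply]
  refine nablaOp_iterate_eq_of_eq_lincomb _ _ k s fun i hi => ?_
  have h := meixnerWeight_add_one_eq_nablaOp (β + ((k + 1 : ℕ) : ℂ) - 1) (s - i) hc0 hc1
    (h1 i hi) fun h0 => h2 i hi (by linear_combination h0)
  rwa [sub_add_cancel] at h
end

section
/- (Lemma 4.2 / three-term recurrence on one ray.) Let c ∈ ℂ with c ≠ 0 and c ≠ 1, β ∈ ℂ, and n ≥ 1 an integer. Write F^β_k := (Ψ^{β+1} ∘ ⋯ ∘ Ψ^{β+k})(1) (with F^β_0 the constant function 1). Then for every s ∈ ℂ, F^β_{n+1}(s) = s·F^β_n(s) + ((c·(n+β) + n)/(c−1))·F^β_n(s) − (c·n·(β+n−1)/(c−1)^2)·F^β_{n−1}(s). -/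
/-- A contiguous relation linking `F^{β+1}_n` at `s - 1` and at `s` with `F^β_n` at `s`. -/
theorem mul_iterRaising_one_sub_one (c : ℂ) (n : ℕ) (β s : ℂ) :
    s * iterRaising c (β + 1) n (fun _ => 1) (s - 1) =
      (s + β) * iterRaising c (β + 1) n (fun _ => 1) s -
        (β + n) * iterRaising c β n (fun _ => 1) s := by
  induction n generalizing β s with
  | zero => simp [iterRaising]
  | succ n ih =>
    have h := ih (β + 1) s
    have h₁ := ih (β + 1) (s - 1)
    simp only [iterRaising, raisingOp]
    push_cast
    linear_combination (c / (c - 1)) * ((s + β) * h - s / c * h₁)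

/-- The three-term recurrence, indexed so as to avoid subtraction on `ℕ`. -/
theorem iterRaising_one_succ_succ (c : ℂ) (hc0 : c ≠ 0) (hc1 : c ≠ 1) (n : ℕ) (β s : ℂ) :
    iterRaising c β (n + 2) (fun _ => 1) s =
      (s + (c * (n + 1 + β) + (n + 1)) / (c - 1)) * iterRaising c β (n + 1) (fun _ => 1) s -
        c * (n + 1) * (β + n) / (c - 1) ^ 2 * iterRaising c β n (fun _ => 1) s := by
  have hc : c - 1 ≠ 0 := sub_ne_zero.mpr hc1
  induction n generalizing β s with
  | zero =>
    simp only [iterRaising, raisingOp]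
    push_cast
    field_simp
    ring
  | succ n ih =>
    have h := ih (β + 1) s
    have h₁ := ih (β + 1) (s - 1)
    have hs := mul_iterRaising_one_sub_one c (n + 1) β s
    have e₂ : iterRaising c β (n + 1 + 2) (fun _ => 1) s = c / (c - 1) *
        ((s + (β + 1) - 1) * iterRaising c (β + 1) (n + 2) (fun _ => 1) s -
          s / c * iterRaising c (β + 1) (n + 2) (fun _ => 1) (s - 1)) := rfl
    have e₁ : iterRaising c β (n + 1 + 1) (fun _ => 1) s = c / (c - 1) *
        ((s + (β + 1) - 1) * iterRaising c (β + 1) (n + 1) (fun _ => 1) s -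
          s / c * iterRaising c (β + 1) (n + 1) (fun _ => 1) (s - 1)) := rfl
    have e₀ : iterRaising c β (n + 1) (fun _ => 1) s = c / (c - 1) *
        ((s + (β + 1) - 1) * iterRaising c (β + 1) n (fun _ => 1) s -
          s / c * iterRaising c (β + 1) n (fun _ => 1) (s - 1)) := rfl
    rw [e₂, h, h₁, e₁]
    generalize iterRaising c (β + 1) (n + 1) (fun _ => 1) s = a at *
    generalize iterRaising c (β + 1) (n + 1) (fun _ => 1) (s - 1) = a' at *
    generalize iterRaising c (β + 1) n (fun _ => 1) s = b at *
    generalize iterRaising c (β + 1) n (fun _ => 1) (s - 1) = b' at *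
    generalize iterRaising c β (n + 1) (fun _ => 1) s = d at *
    push_cast at *
    have hb : c / (c - 1) * (s + β) * b - s / (c - 1) * b' - d = 0 := by
      rw [e₀]; field_simp; ring
    have key : s / (c - 1) * a' - c / (c - 1) ^ 2 * ((s + β) * a - s / c * a')
        + c * (β + n + 1) / (c - 1) ^ 2 * d = 0 := by
      field_simp
      linear_combination c * hs
    linear_combination (norm := skip) key - c * (n + 1) * (β + 1 + n) / (c - 1) ^ 2 * hb
    field_simp
    ring

/-- Lemma 4.2 / three-term recurrence on one ray: with
`F^β_k := (Ψ^{β+1}∘⋯∘Ψ^{β+k})(1)`, one has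
`F^β_{n+1}(s) = s·F^β_n(s) + ((c(n+β)+n)/(c−1))·F^β_n(s) − (cn(β+n−1)/(c−1)^2)·F^β_{n−1}(s)`. -/
theorem meixner_three_term_recurrence (c β : ℂ) (hc0 : c ≠ 0) (hc1 : c ≠ 1)
    (n : ℕ) (hn : 1 ≤ n) (s : ℂ) :
    iterRaising c β (n + 1) (fun _ => 1) s =
      s * iterRaising c β n (fun _ => 1) s +
        ((c * ((n : ℂ) + β) + (n : ℂ)) / (c - 1)) * iterRaising c β n (fun _ => 1) s -
        (c * (n : ℂ) * (β + (n : ℂ) - 1) / (c - 1) ^ 2) *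
          iterRaising c β (n - 1) (fun _ => 1) s := by
  obtain ⟨m, rfl⟩ := Nat.exists_eq_add_of_le' hn
  rw [iterRaising_one_succ_succ c hc0 hc1 m β s, Nat.add_sub_cancel]
  push_cast
  ring
end
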